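/- Let n ≥ 2, 1 < p < ∞, and let Ω ⊂ ℝⁿ be an open set. Let σ be a nonnegative locally finite Borel measure on Ω and suppose u ∈ W^{1,p}_loc(Ω) (i.e., u ∈ L^p_loc(Ω) with weak gradient ∇u ∈ L^p_loc(Ω; ℝⁿ)) satisfies ∫_Ω |∇u|^{p−2} ∇u · ∇φ dx = ∫_Ω |∇u|^p φ dx + ∫_Ω φ dσ for all φ ∈ C_c^∞(Ω). Then ∫_Ω |φ|^p |∇u|^p dx ≤ p^p ∫_Ω |∇φ|^p dx for all φ ∈ C_c^∞(Ω). -/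

import Mathlib

open MeasureTheory Filter Real Metric Bornology
open scoped ENNReal RealInnerProductSpace Topology

noncomputable section

abbrev Euc (n : ℕ) := EuclideanSpace ℝ (Fin n)

/-- `φ` is a test function: smooth, compactly supported, with support contained in `U`. -/
def IsTest (n : ℕ) (U : Set (Euc n)) (φ : Euc n → ℝ) : Prop :=
  ContDiff ℝ (⊤ : ℕ∞) φ ∧ HasCompactSupport φ ∧ tsupport φ ⊆ U

/-- `V` is the weak gradient of `u` on the open set `U`
    (stated against all directions `y`, equivalently componentwise). -/
def IsWeakGrad (n : ℕ) (U : Set (Euc n)) (u : Euc n → ℝ) (V : Euc n → Euc n) : Prop :=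
  ∀ φ : Euc n → ℝ, IsTest n U φ → ∀ y : Euc n,
    ∫ x in U, u x * ⟪gradient φ x, y⟫ = - ∫ x in U, ⟪V x, y⟫ * φ x

/-- The capacity `Cap_{1,p}(K)`. -/
def cap1p (n : ℕ) (p : ℝ) (K : Set (Euc n)) : ℝ :=
  sInf {c : ℝ | ∃ φ : Euc n → ℝ, ContDiff ℝ (⊤ : ℕ∞) φ ∧ HasCompactSupport φ ∧
    (∀ x, 0 ≤ φ x ∧ φ x ≤ 1) ∧ (∀ x ∈ K, 1 ≤ φ x) ∧
    c = ∫ x, (‖gradient φ x‖ ^ p + φ x ^ p)}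

/-- Membership in the space `M^{1,p}(Ω)` of Sobolev multipliers. -/
def MemM1p (n : ℕ) (p : ℝ) (Ω : Set (Euc n)) (f : Euc n → ℝ) : Prop :=
  MemLp f (ENNReal.ofReal p) (volume.restrict Ω) ∧
  ∃ C : ℝ, 0 ≤ C ∧ ∀ K : Set (Euc n), K ⊆ Ω → IsCompact K →
    ∫ x in K, |f x| ^ p ≤ C * cap1p n p K

/-- The norm in `M^{1,p}(Ω)`: the `p`-th root of the least admissible constant. -/
def M1pNorm (n : ℕ) (p : ℝ) (Ω : Set (Euc n)) (f : Euc n → ℝ) : ℝ :=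
  sInf {C : ℝ | 0 ≤ C ∧ ∀ K : Set (Euc n), K ⊆ Ω → IsCompact K →
    ∫ x in K, |f x| ^ p ≤ C * cap1p n p K} ^ (1/p)

/-- `u ∈ W^{1,p}_0(Ω)` with weak gradient `V`. -/
def MemW1p0 (n : ℕ) (p : ℝ) (Ω : Set (Euc n)) (u : Euc n → ℝ) (V : Euc n → Euc n) : Prop :=
  (∀ᵐ x : Euc n, x ∉ Ω → u x = 0) ∧
  MemLp u (ENNReal.ofReal p) volume ∧
  MemLp (fun x => ‖V x‖) (ENNReal.ofReal p) volume ∧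
  IsWeakGrad n Set.univ u V ∧
  ∃ φ : ℕ → Euc n → ℝ, (∀ j, IsTest n Ω (φ j)) ∧
    Tendsto (fun j => (∫ x, |φ j x - u x| ^ p) ^ (1/p)
      + (∫ x, ‖gradient (φ j) x - V x‖ ^ p) ^ (1/p)) atTop (nhds 0)

theorem aux_young (p a b : ℝ) (hp : 1 < p) (ha : 0 ≤ a) (hb : 0 ≤ b) :
    p * (a ^ (p - 1) * b) ≤ (1 - 1 / p) * a ^ p + p ^ (p - 1) * b ^ p := by
  have hp0 : 0 < p := by linarith
  have hpq : (p / (p - 1)).HolderConjugate p := (Real.HolderConjugate.conjExponent hp).symm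
  have h := Real.young_inequality_of_nonneg (a := a ^ (p - 1)) (b := p * b)
    (Real.rpow_nonneg ha _) (by positivity) hpq
  have h1 : (a ^ (p - 1)) ^ (p / (p - 1)) = a ^ p := by
    rw [← Real.rpow_mul ha]
    congr 1
    have : p - 1 ≠ 0 := by linarith
    field_simp
  have h2 : (p * b) ^ p / p = p ^ (p - 1) * b ^ p := by
    rw [Real.mul_rpow hp0.le hb, Real.rpow_sub_one hp0.ne']
    ring
  rw [h1, h2] at h
  have h3 : a ^ p / (p / (p - 1)) = (1 - 1 / p) * a ^ p := by
    have : p - 1 ≠ 0 := by linarith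
    field_simp
  rw [h3] at h
  linarith

theorem aux_deriv (p e t : ℝ) (he : 0 < e) :
    HasDerivAt (fun t : ℝ => (t ^ 2 + e) ^ (p / 2) - e ^ (p / 2))
      (p * t * (t ^ 2 + e) ^ (p / 2 - 1)) t := by
  have hpos : 0 < t ^ 2 + e := by positivity
  have h1 : HasDerivAt (fun t : ℝ => t ^ 2 + e) (2 * t) t := by
    simpa using (hasDerivAt_pow 2 t).add_const e
  have h2 := (h1.rpow_const (p := p / 2) (Or.inl hpos.ne')).sub_const (e ^ (p / 2))
  exact h2.congr_deriv (by ring)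

theorem aux_deriv_le (p e t : ℝ) (hp : 1 < p) (he : 0 < e) :
    |p * t * (t ^ 2 + e) ^ (p / 2 - 1)| ≤ p * ((t ^ 2 + e) ^ (1 / 2 : ℝ)) ^ (p - 1) := by
  have hpos : 0 < t ^ 2 + e := by positivity
  rw [abs_mul, abs_mul, abs_of_pos (by linarith : 0 < p), abs_of_pos (Real.rpow_pos_of_pos hpos _),
    mul_assoc]
  refine mul_le_mul_of_nonneg_left ?_ (by linarith)
  have ht : |t| ≤ (t ^ 2 + e) ^ (1 / 2 : ℝ) := by
    rw [← Real.sqrt_eq_rpow]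
    exact Real.abs_le_sqrt (by linarith)
  calc |t| * (t ^ 2 + e) ^ (p / 2 - 1)
      ≤ (t ^ 2 + e) ^ (1 / 2 : ℝ) * (t ^ 2 + e) ^ (p / 2 - 1) := by gcongr
    _ = ((t ^ 2 + e) ^ (1 / 2 : ℝ)) ^ (p - 1) := by
      rw [← Real.rpow_add hpos, ← Real.rpow_mul hpos.le]
      congr 1
      ring

theorem aux_norm_gradient (n : ℕ) (f : Euc n → ℝ) (x : Euc n) :
    ‖gradient f x‖ = ‖fderiv ℝ f x‖ := by
  simp [gradient]

theorem aux_test (n : ℕ) (p e : ℝ) (he : 0 < e) (Ω : Set (Euc n)) (φ : Euc n → ℝ)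
    (hφ : IsTest n Ω φ) :
    IsTest n Ω (fun x => (φ x ^ 2 + e) ^ (p / 2) - e ^ (p / 2)) ∧
    tsupport (fun x => (φ x ^ 2 + e) ^ (p / 2) - e ^ (p / 2)) ⊆ tsupport φ := by
  have hs : tsupport (fun x => (φ x ^ 2 + e) ^ (p / 2) - e ^ (p / 2)) ⊆ tsupport φ := by
    apply closure_mono
    intro x hx
    contrapose! hx
    have : φ x = 0 := by simpa using hx
    simp [this]
  refine ⟨⟨?_, ?_, hs.trans hφ.2.2⟩, hs⟩
  · refine ContDiff.sub (ContDiff.rpow_const_of_ne ?_ ?_) contDiff_const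
    · exact (hφ.1.pow 2).add contDiff_const
    · intro x
      positivity
  · exact hφ.2.1.of_isClosed_subset (isClosed_tsupport _) hs

theorem aux_grad_le (n : ℕ) (p e : ℝ) (hp : 1 < p) (he : 0 < e) (Ω : Set (Euc n)) (φ : Euc n → ℝ)
    (hφ : IsTest n Ω φ) (x : Euc n) :
    ‖gradient (fun x => (φ x ^ 2 + e) ^ (p / 2) - e ^ (p / 2)) x‖ ≤
      p * ((φ x ^ 2 + e) ^ (1 / 2 : ℝ)) ^ (p - 1) * ‖gradient φ x‖ := by
  rw [aux_norm_gradient, aux_norm_gradient]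
  have hd : HasFDerivAt φ (fderiv ℝ φ x) x :=
    (hφ.1.differentiable (by simp) x).hasFDerivAt
  have := (aux_deriv p e (φ x) he).comp_hasFDerivAt x hd
  have h2 : fderiv ℝ (fun x => (φ x ^ 2 + e) ^ (p / 2) - e ^ (p / 2)) x = _ := this.fderiv
  rw [h2, norm_smul, Real.norm_eq_abs]
  gcongr
  exact aux_deriv_le p e (φ x) hp he

theorem aux_pt (n : ℕ) (p e : ℝ) (hp : 1 < p) (he : 0 < e) (Ω : Set (Euc n)) (φ : Euc n → ℝ)
    (hφ : IsTest n Ω φ) (v x : Euc n) :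
    ‖‖v‖ ^ (p - 2) * ⟪v, gradient (fun x => (φ x ^ 2 + e) ^ (p / 2) - e ^ (p / 2)) x⟫‖ ≤
      (1 - 1 / p) * (‖v‖ ^ p * (φ x ^ 2 + e) ^ (p / 2)) + p ^ (p - 1) * ‖gradient φ x‖ ^ p := by
  have hpos : 0 < φ x ^ 2 + e := by positivity
  set s := (φ x ^ 2 + e) ^ (1 / 2 : ℝ) with hs
  have hs0 : 0 < s := Real.rpow_pos_of_pos hpos _
  have hsp : (φ x ^ 2 + e) ^ (p / 2) = s ^ p := by
    rw [hs, ← Real.rpow_mul hpos.le]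
    congr 1
    ring
  have hy := aux_young p (‖v‖ * s) ‖gradient φ x‖ hp (by positivity) (by positivity)
  rw [Real.mul_rpow (norm_nonneg _) hs0.le, Real.mul_rpow (norm_nonneg _) hs0.le] at hy
  have hg := aux_grad_le n p e hp he Ω φ hφ x
  rw [← hs] at hg
  have hv : ‖v‖ ^ (p - 2) * ‖v‖ ≤ ‖v‖ ^ (p - 1) := by
    rcases eq_or_ne v 0 with rfl | h
    · simp only [norm_zero, mul_zero]
      exact Real.rpow_nonneg le_rfl _
    · have hv0 : 0 < ‖v‖ := norm_pos_iff.2 h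
      rw [← Real.rpow_add_one hv0.ne']
      apply le_of_eq
      congr 1
      ring
  rw [hsp]
  refine le_trans ?_ hy
  rw [norm_mul, Real.norm_of_nonneg (Real.rpow_nonneg (norm_nonneg _) _)]
  calc _ ≤ ‖v‖ ^ (p - 2) * (‖v‖ * (p * s ^ (p - 1) * ‖gradient φ x‖)) := by
        refine mul_le_mul_of_nonneg_left ?_ (Real.rpow_nonneg (norm_nonneg _) _)
        exact (norm_inner_le_norm _ _).trans (mul_le_mul_of_nonneg_left hg (norm_nonneg _))
    _ = (‖v‖ ^ (p - 2) * ‖v‖) * (p * s ^ (p - 1) * ‖gradient φ x‖) := by ring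
    _ ≤ ‖v‖ ^ (p - 1) * (p * s ^ (p - 1) * ‖gradient φ x‖) := by
        refine mul_le_mul_of_nonneg_right hv (by positivity)
    _ = _ := by ring

theorem aux_grad_zero (n : ℕ) (f : Euc n → ℝ) (x : Euc n) (hx : x ∉ tsupport f) :
    gradient f x = 0 := by
  have h : fderiv ℝ f x = 0 := by
    by_contra h
    exact hx (support_fderiv_subset ℝ h)
  simp [gradient, h]

/-- the weighted inequality satisfied by `|∇u|^p` for any local
solution of `−Δ_p u = |∇u|^p + σ`. -/
theorem statement13 (n : ℕ) (hn : 2 ≤ n) (p : ℝ) (hp : 1 < p)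
    (Ω : Set (Euc n)) (hΩo : IsOpen Ω)
    (σ : Measure (Euc n))
    (hσloc : ∀ x ∈ Ω, ∃ U : Set (Euc n), IsOpen U ∧ x ∈ U ∧ σ U < ⊤)
    (u : Euc n → ℝ) (V : Euc n → Euc n)
    (hloc : ∀ K : Set (Euc n), K ⊆ Ω → IsCompact K →
      IntegrableOn (fun x => |u x| ^ p) K volume ∧
      IntegrableOn (fun x => ‖V x‖ ^ p) K volume)
    (hgrad : IsWeakGrad n Ω u V)
    (heq : ∀ φ : Euc n → ℝ, IsTest n Ω φ →
      ∫ x in Ω, ‖V x‖ ^ (p - 2) * ⟪V x, gradient φ x⟫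
        = (∫ x in Ω, ‖V x‖ ^ p * φ x) + ∫ x, φ x ∂σ) :
    ∀ φ : Euc n → ℝ, IsTest n Ω φ →
      ∫ x in Ω, |φ x| ^ p * ‖V x‖ ^ p ≤ p ^ p * ∫ x in Ω, ‖gradient φ x‖ ^ p := by
  intro φ hφ
  have hp0 : 0 < p := by linarith
  have hm : MeasurableSet Ω := hΩo.measurableSet
  have hK : IsCompact (tsupport φ) := hφ.2.1
  have hKΩ : tsupport φ ⊆ Ω := hφ.2.2
  have hV := (hloc _ hKΩ hK).2
  have hc : Continuous φ := hφ.1.continuous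
  have hgc : Continuous (fun x => ‖gradient φ x‖ ^ p) := by
    simp_rw [aux_norm_gradient]
    exact ((hφ.1.continuous_fderiv (by simp)).norm).rpow_const (fun _ => Or.inr hp0.le)
  have hφ0 : ∀ x, x ∉ tsupport φ → φ x = 0 := fun x hx => image_eq_zero_of_notMem_tsupport hx
  have red : ∀ f : Euc n → ℝ, (∀ x, x ∉ tsupport φ → f x = 0) →
      ∫ x in Ω, f x = ∫ x in tsupport φ, f x := by
    intro f hf
    exact setIntegral_eq_of_subset_of_forall_sdiff_eq_zero hm hKΩ (fun x hx => hf x hx.2)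
  rw [red (fun x => |φ x| ^ p * ‖V x‖ ^ p)
    (by intro x hx; simp [hφ0 x hx, Real.zero_rpow hp0.ne']),
    red (fun x => ‖gradient φ x‖ ^ p)
    (by intro x hx; simp [aux_grad_zero n φ x hx, Real.zero_rpow hp0.ne'])]
  set K := tsupport φ with hKdef
  set C := ∫ x in K, ‖V x‖ ^ p with hC
  set X := ∫ x in K, |φ x| ^ p * ‖V x‖ ^ p with hX
  set Y := ∫ x in K, ‖gradient φ x‖ ^ p with hY
  have hYi : IntegrableOn (fun x => ‖gradient φ x‖ ^ p) K := hgc.continuousOn.integrableOn_compact hK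
  have key : ∀ e : ℝ, 0 < e → X ≤ p ^ p * Y + p * C * e ^ (p / 2) := by
    intro e he
    obtain ⟨ht, hts⟩ := aux_test n p e he Ω φ hφ
    have hE := heq _ ht
    have hsc : Continuous (fun x => (φ x ^ 2 + e) ^ (p / 2)) :=
      ((hc.pow 2).add continuous_const).rpow_const (fun _ => Or.inr (by positivity))
    have hSi : IntegrableOn (fun x => ‖V x‖ ^ p * (φ x ^ 2 + e) ^ (p / 2)) K :=
      hV.mul_continuousOn hsc.continuousOn hK
    have hψ0 : ∀ x, 0 ≤ (φ x ^ 2 + e) ^ (p / 2) - e ^ (p / 2) := by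
      intro x
      rw [sub_nonneg]
      exact Real.rpow_le_rpow he.le (by nlinarith [sq_nonneg (φ x)]) (by positivity)
    have hσ0 : 0 ≤ ∫ x, ((φ x ^ 2 + e) ^ (p / 2) - e ^ (p / 2)) ∂σ := integral_nonneg hψ0
    rw [red _ (by
        intro x hx
        rw [aux_grad_zero n _ x (fun h => hx (hts h))]
        simp), red _ (by intro x hx; simp [hφ0 x hx])] at hE
    have h1 : ∫ x in K, ‖V x‖ ^ p * ((φ x ^ 2 + e) ^ (p / 2) - e ^ (p / 2)) =
        (∫ x in K, ‖V x‖ ^ p * (φ x ^ 2 + e) ^ (p / 2)) - C * e ^ (p / 2) := by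
      simp_rw [mul_sub]
      rw [integral_sub hSi (hV.mul_const _), integral_mul_const]
    set S := ∫ x in K, ‖V x‖ ^ p * (φ x ^ 2 + e) ^ (p / 2) with hS
    have h2 : ∫ x in K, ((1 - 1 / p) * (‖V x‖ ^ p * (φ x ^ 2 + e) ^ (p / 2))
        + p ^ (p - 1) * ‖gradient φ x‖ ^ p) = (1 - 1 / p) * S + p ^ (p - 1) * Y := by
      rw [integral_add (hSi.const_mul _) (hYi.const_mul _), integral_const_mul, integral_const_mul]
    have h3 := norm_integral_le_of_norm_le ((hSi.const_mul (1 - 1 / p)).add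
      (hYi.const_mul (p ^ (p - 1))))
      (Eventually.of_forall (fun x => aux_pt n p e hp he Ω φ hφ (V x) x))
    have h3' := (le_abs_self _).trans (h3.trans_eq h2)
    have hXS : X ≤ S := by
      have hap : Continuous (fun x => |φ x| ^ p) :=
        hc.abs.rpow_const (fun _ => Or.inr hp0.le)
      refine integral_mono ?_ hSi ?_
      · have := hV.mul_continuousOn hap.continuousOn hK
        simp only [mul_comm] at this
        exact this
      · intro x
        show |φ x| ^ p * ‖V x‖ ^ p ≤ ‖V x‖ ^ p * (φ x ^ 2 + e) ^ (p / 2)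
        rw [mul_comm]
        refine mul_le_mul_of_nonneg_left ?_ (by positivity)
        have : |φ x| ^ p = (φ x ^ 2) ^ (p / 2) := by
          rw [← sq_abs, ← Real.rpow_natCast, ← Real.rpow_mul (abs_nonneg _)]
          congr 1
          push_cast
          ring
        rw [this]
        exact Real.rpow_le_rpow (by positivity) (by linarith) (by positivity)
    rw [h1] at hE
    have h4 : S / p ≤ p ^ (p - 1) * Y + C * e ^ (p / 2) := by
      have : (1 - 1 / p) * S = S - S / p := by ring
      linarith
    have h5 : S ≤ p * (p ^ (p - 1) * Y + C * e ^ (p / 2)) := by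
      rw [div_le_iff₀ hp0] at h4
      linarith
    have h6 : p * p ^ (p - 1) = p ^ p := by
      rw [Real.rpow_sub_one hp0.ne']
      field_simp
    calc X ≤ S := hXS
      _ ≤ _ := h5
      _ = (p * p ^ (p - 1)) * Y + p * C * e ^ (p / 2) := by ring
      _ = _ := by rw [h6]
  have hlim : Tendsto (fun e : ℝ => p ^ p * Y + p * C * e ^ (p / 2)) (𝓝[>] 0)
      (𝓝 (p ^ p * Y + p * C * (0 : ℝ) ^ (p / 2))) := by
    refine Tendsto.mono_left ?_ nhdsWithin_le_nhds
    exact (continuous_const.add (continuous_const.mul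
      (Real.continuous_rpow_const (by positivity)))).tendsto 0
  rw [Real.zero_rpow (by positivity), mul_zero, add_zero] at hlim
  exact ge_of_tendsto hlim (eventually_mem_nhdsWithin.mono key)

end
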